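/- Let d ≥ 2, α ∈ (0,∞), q ∈ [1,∞), and n ≥ 4. Let v_1, …, v_n ∈ ℝ^d (indices mod n) be pairwise distinct vertices of an equilateral closed polygon with |v_{i+1} − v_i| = 1/n for all i, and let E_n^{α,q} := (1/(α n²)) Σ_{1≤i,j≤n, i≠j} ( |v_j − v_i|^{−α} − ( [|j−i|]_n / n )^{−α} )^q be its discrete O'Hara energy, where [k]_n := min{k, n−k}. Then E_n^{α,q} ≥ (n^{αq−1}/α) Σ_{k=1}^{n−1} ( sin^α(π/n) / sin^α([k]_n π/n) − 1/[k]_n^α )^q, with equality if and only if v_1, …, v_n are, in cyclic order, the vertices of a planar regular n-gon with edge length 1/n. In particular, the minimizers of the discrete energy among all equilateral closed polygons with n edges and total length 1 are exactly the regular n-gons, uniquely up to rigid motions. -/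

import Mathlib

open Real

/-- `v` lists (for all `i : ℤ`, with period `n`) the vertices, in cyclic order, of a planar
regular `n`-gon with edge length `1/n` (circumradius `1 / (2 n sin (π/n))`). -/
def IsRegularNGon (d n : ℕ) (v : ℤ → EuclideanSpace ℝ (Fin d)) : Prop :=
  ∃ (o e₁ e₂ : EuclideanSpace ℝ (Fin d)) (θ : ℝ),
    ‖e₁‖ = 1 ∧ ‖e₂‖ = 1 ∧ (inner ℝ e₁ e₂ : ℝ) = 0 ∧
    ∀ i : ℤ, v i = o + (1 / (2 * n * Real.sin (Real.pi / n))) •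
      (Real.cos (2 * Real.pi * i / n + θ) • e₁ + Real.sin (2 * Real.pi * i / n + θ) • e₂)

/-- discrete O'Hara `(α,q)`-energy of an equilateral closed polygon with `n` edges,
total length `1`, and vertices `v 1, …, v n`. -/
noncomputable def discPolyE (d n : ℕ) (α q : ℝ) (v : ℤ → EuclideanSpace ℝ (Fin d)) : ℝ :=
  (1 / (α * (n : ℝ) ^ 2)) *
    ∑ i ∈ Finset.Icc (1 : ℤ) (n : ℤ), ∑ j ∈ Finset.Icc (1 : ℤ) (n : ℤ),
      (if i = j then 0 else
        (‖v j - v i‖ ^ (-α) -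
          (((min |j - i| ((n : ℤ) - |j - i|) : ℤ) : ℝ) / n) ^ (-α)) ^ q)

/-- Tangent-line bound for the convex function `s ↦ s ^ (-α / 2)`, strict off the base point. -/
lemma tangent_lt_rpow_neg {α r D : ℝ} (hα : 0 < α) (hr : 0 < r) (hD : 0 < D) (hne : r ≠ D) :
    D ^ (-α) * (1 - α / 2 * (r ^ 2 / D ^ 2 - 1)) < r ^ (-α) := by
  have ht : 0 < r ^ 2 / D ^ 2 := by positivity
  have ht1 : r ^ 2 / D ^ 2 ≠ 1 := by
    intro h
    rw [div_eq_one_iff_eq (by positivity)] at h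
    exact hne ((sq_eq_sq₀ hr.le hD.le).1 h)
  have hlog : log (r ^ 2 / D ^ 2) < r ^ 2 / D ^ 2 - 1 := log_lt_sub_one_of_pos ht ht1
  have hlog2 : log (r ^ 2 / D ^ 2) = 2 * log (r / D) := by
    rw [← div_pow, log_pow]; norm_num
  have hr' : r ^ (-α) = D ^ (-α) * (r / D) ^ (-α) := by
    rw [← mul_rpow hD.le (by positivity)]
    congr 1
    field_simp
  rw [hr']
  refine mul_lt_mul_of_pos_left ?_ (rpow_pos_of_pos hD _)
  rw [rpow_def_of_pos (by positivity : 0 < r / D)]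
  have := add_one_le_exp (log (r / D) * -α)
  nlinarith

lemma tangent_le_rpow_neg {α r D : ℝ} (hα : 0 < α) (hr : 0 < r) (hD : 0 < D) :
    D ^ (-α) * (1 - α / 2 * (r ^ 2 / D ^ 2 - 1)) ≤ r ^ (-α) := by
  by_cases h : r = D
  · subst h
    rw [div_self (by positivity)]
    simp
  · exact (tangent_lt_rpow_neg hα hr hD h).le

lemma sum_tangent_le {ι : Type*} {s : Finset ι} {α D : ℝ} {r : ι → ℝ} (hα : 0 < α) (hD : 0 < D)
    (hsum : ∑ i ∈ s, r i ^ 2 ≤ s.card * D ^ 2) :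
    s.card * D ^ (-α) ≤ ∑ i ∈ s, D ^ (-α) * (1 - α / 2 * (r i ^ 2 / D ^ 2 - 1)) := by
  rw [← Finset.mul_sum, Finset.sum_sub_distrib, ← Finset.mul_sum, Finset.sum_sub_distrib,
    ← Finset.sum_div, mul_comm]
  refine mul_le_mul_of_nonneg_left ?_ (rpow_nonneg hD.le _)
  have : (∑ i ∈ s, r i ^ 2) / D ^ 2 ≤ s.card := by
    rw [div_le_iff₀ (by positivity)]; exact hsum
  simp only [Finset.sum_const, nsmul_eq_mul, mul_one]
  nlinarith

lemma card_mul_rpow_le_sum {ι : Type*} {s : Finset ι} (hs : s.Nonempty) {q m : ℝ} (hq : 1 ≤ q)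
    {y : ι → ℝ} (hy : ∀ i ∈ s, 0 ≤ y i) (hm : 0 ≤ m) (hsum : s.card * m ≤ ∑ i ∈ s, y i) :
    s.card * m ^ q ≤ ∑ i ∈ s, y i ^ q := by
  have hc : (0 : ℝ) < s.card := by exact_mod_cast hs.card_pos
  have h := rpow_arith_mean_le_arith_mean_rpow s (fun _ ↦ (s.card : ℝ)⁻¹) y
    (fun _ _ ↦ by positivity) (by simp [hc.ne']) hy hq
  rw [← Finset.mul_sum, ← Finset.mul_sum] at h
  have h2 : m ^ q ≤ ((s.card : ℝ)⁻¹ * ∑ i ∈ s, y i) ^ q := by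
    refine rpow_le_rpow hm ?_ (by linarith)
    rw [le_inv_mul_iff₀ hc]; exact hsum
  have := h2.trans h
  rwa [le_inv_mul_iff₀ hc] at this

lemma card_mul_rpow_lt_sum {ι : Type*} {s : Finset ι} (hs : s.Nonempty) {q m : ℝ} (hq : 1 ≤ q)
    {y : ι → ℝ} (hy : ∀ i ∈ s, 0 ≤ y i) (hm : 0 ≤ m) (hsum : s.card * m < ∑ i ∈ s, y i) :
    s.card * m ^ q < ∑ i ∈ s, y i ^ q := by
  have hc : (0 : ℝ) < s.card := by exact_mod_cast hs.card_pos
  set M := (∑ i ∈ s, y i) / s.card with hM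
  have hmM : m < M := by rw [hM, lt_div_iff₀ hc]; linarith
  calc s.card * m ^ q < s.card * M ^ q := by
        gcongr
    _ ≤ _ := card_mul_rpow_le_sum hs hq hy (hm.trans hmM.le) (by rw [hM]; field_simp; exact le_rfl)

lemma energy_layer_le {ι : Type*} {s : Finset ι} (hs : s.Nonempty) {α q c D : ℝ} {r : ι → ℝ}
    (hα : 0 < α) (hq : 1 ≤ q) (hD : 0 < D) (hr : ∀ i ∈ s, 0 < r i)
    (hc : ∀ i ∈ s, c ≤ r i ^ (-α)) (hcD : c ≤ D ^ (-α))
    (hsum : ∑ i ∈ s, r i ^ 2 ≤ s.card * D ^ 2) :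
    s.card * (D ^ (-α) - c) ^ q ≤ ∑ i ∈ s, (r i ^ (-α) - c) ^ q := by
  refine card_mul_rpow_le_sum hs hq (fun i hi ↦ sub_nonneg.2 (hc i hi)) (sub_nonneg.2 hcD) ?_
  have h1 := sum_tangent_le hα hD hsum
  have h2 := Finset.sum_le_sum fun i hi ↦ tangent_le_rpow_neg hα (hr i hi) hD
  rw [Finset.sum_sub_distrib, Finset.sum_const, nsmul_eq_mul]
  linarith

lemma eq_of_energy_layer_eq {ι : Type*} {s : Finset ι} (hs : s.Nonempty) {α q c D : ℝ} {r : ι → ℝ}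
    (hα : 0 < α) (hq : 1 ≤ q) (hD : 0 < D) (hr : ∀ i ∈ s, 0 < r i)
    (hc : ∀ i ∈ s, c ≤ r i ^ (-α)) (hcD : c ≤ D ^ (-α))
    (hsum : ∑ i ∈ s, r i ^ 2 ≤ s.card * D ^ 2)
    (heq : s.card * (D ^ (-α) - c) ^ q = ∑ i ∈ s, (r i ^ (-α) - c) ^ q) :
    ∀ i ∈ s, r i = D := by
  by_contra! hne
  obtain ⟨j, hj, hjD⟩ := hne
  refine heq.not_lt (card_mul_rpow_lt_sum hs hq (fun i hi ↦ sub_nonneg.2 (hc i hi))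
    (sub_nonneg.2 hcD) ?_)
  have h1 := sum_tangent_le hα hD hsum
  have h2 := Finset.sum_lt_sum (fun i hi ↦ tangent_le_rpow_neg hα (hr i hi) hD)
    ⟨j, hj, tangent_lt_rpow_neg hα (hr j hj) hD hjD⟩
  rw [Finset.sum_sub_distrib, Finset.sum_const, nsmul_eq_mul]
  linarith

lemma sin_nat_mul_mul_sin_le {s t : ℝ} (hs : 0 < s) (hst : s ≤ t) (k : ℕ) (hk : k * t ≤ π / 2)
    (ht : t ≤ π / 2) :
    sin (k * t) * sin s ≤ sin (k * s) * sin t := by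
  induction k with
  | zero => simp
  | succ k ih =>
    push_cast at hk ⊢
    have hk' : k * t ≤ π / 2 := by nlinarith
    have hks : (k : ℝ) * s ≤ k * t := by gcongr
    have hk0 : (0 : ℝ) ≤ k * s := by positivity
    have hpi := pi_pos
    have c1 : cos t ≤ cos s := cos_le_cos_of_nonneg_of_le_pi hs.le (by linarith) hst
    have c2 : cos (k * t) ≤ cos (k * s) := cos_le_cos_of_nonneg_of_le_pi hk0 (by linarith) hks
    have p1 : 0 ≤ sin s := sin_nonneg_of_nonneg_of_le_pi hs.le (by linarith)
    have p2 : 0 ≤ sin t := sin_nonneg_of_nonneg_of_le_pi (by linarith) (by linarith)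
    have p3 : 0 ≤ cos t := cos_nonneg_of_neg_pi_div_two_le_of_le (by linarith) (by linarith)
    have p4 : 0 ≤ sin (k * s) := sin_nonneg_of_nonneg_of_le_pi hk0 (by linarith)
    rw [add_mul, one_mul, add_mul, one_mul, sin_add, sin_add]
    have e1 := mul_le_mul_of_nonneg_right (ih hk') p3
    have e2 := mul_le_mul_of_nonneg_left c1 (mul_nonneg p4 p2)
    have e3 := mul_le_mul_of_nonneg_right c2 (mul_nonneg p1 p2)
    nlinarith

lemma abs_sin_mul_le_of_le_half {n k m : ℕ} (hk : 1 ≤ k) (hm : 1 ≤ m)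
    (hkn : 2 * k ≤ n) (hmn : 2 * m ≤ n) :
    |sin (m * k * (π / n))| * sin (π / n) ≤ sin (k * (π / n)) * sin (m * (π / n)) := by
  have hn : (0 : ℝ) < n := by exact_mod_cast (by omega : 0 < n)
  set x := π / n with hx
  have hpi := pi_pos
  have hx0 : 0 < x := by positivity
  have hxn : n * x = π := by rw [hx]; field_simp
  have hk1 : (1 : ℝ) ≤ k := by exact_mod_cast hk
  have hm1 : (1 : ℝ) ≤ m := by exact_mod_cast hm
  have hkn' : (2 : ℝ) * k ≤ n := by exact_mod_cast hkn
  have hmn' : (2 : ℝ) * m ≤ n := by exact_mod_cast hmn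
  have hkx : k * x ≤ π / 2 := by nlinarith
  have hmx : m * x ≤ π / 2 := by nlinarith
  have hxm : x ≤ m * x := by nlinarith
  have hxk : x ≤ k * x := by nlinarith
  by_cases h : k * (m * x) ≤ π / 2
  · rw [abs_of_nonneg, mul_comm (m : ℝ) k, mul_assoc]
    · exact sin_nat_mul_mul_sin_le hx0 hxm k h hmx
    · exact sin_nonneg_of_nonneg_of_le_pi (by positivity) (by nlinarith)
  · push Not at h
    have ht : k * (π / (2 * k)) = π / 2 := by field_simp
    have h1 := sin_nat_mul_mul_sin_le hx0 (t := π / (2 * k))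
      (by rw [le_div_iff₀ (by positivity)]; linarith) k ht.le
      (by rw [div_le_div_iff₀ (by positivity) (by positivity)]; nlinarith)
    rw [ht, sin_pi_div_two, one_mul] at h1
    have h2 : sin (π / (2 * k)) ≤ sin (m * x) := by
      refine sin_le_sin_of_le_of_le_pi_div_two ?_ hmx ?_
      · have : 0 ≤ π / (2 * k) := by positivity
        linarith
      · rw [div_le_iff₀ (by positivity)]; linarith
    have h3 : 0 ≤ sin (k * x) := sin_nonneg_of_nonneg_of_le_pi (by positivity) (by linarith)
    have h4 : 0 ≤ sin x := sin_nonneg_of_nonneg_of_le_pi hx0.le (by linarith)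
    calc |sin (m * k * x)| * sin x ≤ 1 * sin x := by
          gcongr; exact abs_sin_le_one _
      _ ≤ sin (k * x) * sin (π / (2 * k)) := by linarith
      _ ≤ _ := by gcongr

lemma sin_sub_mul_pi_div {n k : ℕ} (hn : 0 < n) (hk : k ≤ n) :
    sin ((n - k : ℕ) * (π / n)) = sin (k * (π / n)) := by
  have hn' : (n : ℝ) ≠ 0 := by positivity
  rw [← sin_pi_sub]
  congr 1
  push_cast [hk]
  field_simp
  ring

lemma abs_sin_mul_sub_mul_pi_div {n k : ℕ} (m : ℕ) (hn : 0 < n) (hk : k ≤ n) :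
    |sin (m * (n - k : ℕ) * (π / n))| = |sin (m * k * (π / n))| := by
  have hn' : (n : ℝ) ≠ 0 := by positivity
  have : (m * (n - k : ℕ) * (π / n) : ℝ) = m * π - m * k * (π / n) := by
    push_cast [hk]
    field_simp
  rw [this, ← abs_neg, ← sin_neg, neg_sub, sin_sub_nat_mul_pi, abs_mul]
  simp

lemma abs_sin_mul_le {n k m : ℕ} (hk : 1 ≤ k) (hm : 1 ≤ m) (hkn : k < n) (hmn : m < n) :
    |sin (m * k * (π / n))| * sin (π / n) ≤ sin (k * (π / n)) * sin (m * (π / n)) := by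
  wlog h : 2 * k ≤ n generalizing k
  · have := this (k := n - k) (by omega) (by omega) (by omega)
    rwa [abs_sin_mul_sub_mul_pi_div m (by omega) hkn.le, sin_sub_mul_pi_div (by omega) hkn.le]
      at this
  wlog h' : 2 * m ≤ n generalizing m
  · have := this (m := n - m) (by omega) (by omega) (by omega)
    rwa [mul_comm ((n - m : ℕ) : ℝ), abs_sin_mul_sub_mul_pi_div k (by omega) hmn.le,
      sin_sub_mul_pi_div (by omega) hmn.le, mul_comm (k : ℝ)] at this
  exact abs_sin_mul_le_of_le_half hk hm h h'

open ZMod in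
/-- Parseval's identity on `ZMod n`. -/
lemma sum_normSq_dft {n : ℕ} [NeZero n] (f : ZMod n → ℂ) :
    ∑ m, ‖dft f m‖ ^ 2 = n * ∑ j, ‖f j‖ ^ 2 := by
  have hchar : ∀ x : ZMod n, (starRingEnd ℂ) (stdAddChar (-x)) = stdAddChar x := by
    intro x
    rw [AddChar.map_neg_eq_conj, Complex.conj_conj]
  have h : ∑ m, (starRingEnd ℂ) (dft f m) * dft f m = n * ∑ j, (starRingEnd ℂ) (f j) * f j := by
    calc _ = ∑ m, ∑ j, (starRingEnd ℂ) (f j) * (stdAddChar (j * m) * dft f m) := by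
          refine Finset.sum_congr rfl fun m _ ↦ ?_
          conv_lhs => rw [dft_apply f m]
          rw [map_sum, Finset.sum_mul]
          refine Finset.sum_congr rfl fun j _ ↦ ?_
          rw [smul_eq_mul, map_mul, hchar, dft_apply]
          ring
      _ = ∑ j, (starRingEnd ℂ) (f j) * dft (dft f) (-j) := by
          rw [Finset.sum_comm]
          refine Finset.sum_congr rfl fun j _ ↦ ?_
          rw [← Finset.mul_sum, dft_apply (dft f)]
          congr 1
          refine Finset.sum_congr rfl fun m _ ↦ ?_
          rw [smul_eq_mul]
          congr 2
          ring
      _ = _ := by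
          rw [dft_dft, Finset.mul_sum]
          refine Finset.sum_congr rfl fun j _ ↦ ?_
          simp only [neg_neg, smul_eq_mul]
          ring
  simp only [Complex.conj_mul'] at h
  exact_mod_cast h

open ZMod in
lemma dft_comp_add {n : ℕ} [NeZero n] (f : ZMod n → ℂ) (k m : ZMod n) :
    dft (fun j ↦ f (j + k) - f j) m = (stdAddChar (k * m) - 1) * dft f m := by
  rw [sub_mul, one_mul]
  simp only [dft_apply, smul_eq_mul, mul_sub, Finset.sum_sub_distrib]
  congr 1
  rw [Finset.mul_sum]
  refine Fintype.sum_equiv (Equiv.addRight k) _ _ fun j ↦ ?_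
  rw [Equiv.coe_addRight, ← mul_assoc, ← AddChar.map_add_eq_mul]
  congr 2
  ring

lemma norm_stdAddChar_sub_one {n : ℕ} [NeZero n] (k m : ℕ) :
    ‖ZMod.stdAddChar ((k : ZMod n) * (m : ZMod n)) - 1‖ = 2 * |sin (m * k * (π / n))| := by
  have h := ZMod.stdAddChar_coe (N := n) ((k * m : ℕ) : ℤ)
  push_cast at h
  rw [h]
  have h2 : (2 * π * Complex.I * (k * m) / n : ℂ) =
      Complex.I * ((2 * (m * k * (π / n)) : ℝ) : ℂ) := by
    push_cast; ring
  rw [h2, Complex.norm_exp_I_mul_ofReal_sub_one]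
  simp

lemma sum_norm_shift_sub_le {n : ℕ} [NeZero n] (f : ZMod n → ℂ) {k : ℕ} (hk : 1 ≤ k)
    (hkn : k < n) :
    sin (π / n) ^ 2 * ∑ j, ‖f (j + k) - f j‖ ^ 2 ≤
      sin (k * (π / n)) ^ 2 * ∑ j, ‖f (j + 1) - f j‖ ^ 2 := by
  have hn : (0 : ℝ) < n := by exact_mod_cast (by omega : 0 < n)
  refine le_of_mul_le_mul_left ?_ hn
  rw [mul_left_comm, mul_left_comm (n : ℝ), ← sum_normSq_dft, ← sum_normSq_dft, Finset.mul_sum,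
    Finset.mul_sum]
  refine Finset.sum_le_sum fun m _ ↦ ?_
  have h1 := norm_stdAddChar_sub_one (n := n) 1 m.val
  have h2 := norm_stdAddChar_sub_one (n := n) k m.val
  rw [ZMod.natCast_zmod_val] at h1 h2
  rw [Nat.cast_one, Nat.cast_one, mul_one] at h1
  rw [dft_comp_add, dft_comp_add, norm_mul, norm_mul, h1, h2]
  have key : |sin (m.val * k * (π / n))| * sin (π / n) ≤
      sin (k * (π / n)) * |sin (m.val * (π / n))| := by
    rcases Nat.eq_zero_or_pos m.val with h0 | h0
    · simp [h0]
    · refine (abs_sin_mul_le hk h0 hkn m.val_lt).trans ?_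
      have : 0 ≤ sin (k * (π / n)) := by
        refine sin_nonneg_of_nonneg_of_le_pi (by positivity) ?_
        rw [← mul_div_assoc, div_le_iff₀ hn, mul_comm]
        gcongr
      gcongr
      exact le_abs_self _
  have h0 : 0 ≤ sin (π / n) := by
    refine sin_nonneg_of_nonneg_of_le_pi (by positivity) ?_
    refine div_le_self pi_pos.le ?_
    exact_mod_cast (by omega : 1 ≤ n)
  have := pow_le_pow_left₀ (by positivity) key 2
  nlinarith [mul_le_mul_of_nonneg_right this (sq_nonneg (2 * ‖ZMod.dft f m‖))]

lemma sum_Icc_eq_sum_zmod {n : ℕ} [NeZero n] (G : ZMod n → ℝ) :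
    ∑ i ∈ Finset.Icc (1 : ℤ) n, G i = ∑ x, G x := by
  classical
  have hinj : Set.InjOn (fun i : ℤ ↦ (i : ZMod n)) (Finset.Icc (1 : ℤ) n) := by
    intro a ha b hb hab
    simp only [Finset.coe_Icc, Set.mem_Icc] at ha hb
    have hd := (ZMod.intCast_eq_intCast_iff_dvd_sub a b n).1 hab
    have := Int.eq_zero_of_abs_lt_dvd hd (by rw [abs_lt]; omega)
    omega
  have himg : (Finset.Icc (1 : ℤ) n).image (fun i : ℤ ↦ (i : ZMod n)) = Finset.univ := by
    refine Finset.eq_univ_of_card _ ?_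
    rw [Finset.card_image_of_injOn hinj, ZMod.card]
    simp
  rw [← himg, Finset.sum_image hinj]

lemma sin_sq_mul_sum_norm_sq_le {d n : ℕ} (v : ℤ → EuclideanSpace ℝ (Fin d))
    (hvper : ∀ i : ℤ, v (i + (n : ℤ)) = v i) {k : ℕ} (hk : 1 ≤ k) (hkn : k < n) :
    sin (π / n) ^ 2 * ∑ i ∈ Finset.Icc (1 : ℤ) n, ‖v (i + k) - v i‖ ^ 2 ≤
      sin (k * (π / n)) ^ 2 * ∑ i ∈ Finset.Icc (1 : ℤ) n, ‖v (i + 1) - v i‖ ^ 2 := by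
  have : NeZero n := ⟨by omega⟩
  have hlift : ∀ i : ℤ, v ((i : ZMod n).val : ℤ) = v i := by
    intro i
    rw [ZMod.val_intCast, Int.emod_def, mul_comm, ← smul_eq_mul]
    exact Function.Periodic.sub_zsmul_eq (f := v) hvper _
  have hcoord : ∀ (c : Fin d) (l : ℕ), ∑ i ∈ Finset.Icc (1 : ℤ) n, (v (i + l) c - v i c) ^ 2 =
      ∑ j : ZMod n, ‖((v ((j + l).val : ℤ) c : ℝ) : ℂ) - ((v (j.val : ℤ) c : ℝ) : ℂ)‖ ^ 2 := by
    intro c l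
    rw [← sum_Icc_eq_sum_zmod]
    refine Finset.sum_congr rfl fun i _ ↦ ?_
    have h : ((i : ZMod n) + (l : ZMod n)) = ((i + l : ℤ) : ZMod n) := by push_cast; rfl
    rw [h, hlift, hlift, ← Complex.ofReal_sub, Complex.norm_real, norm_eq_abs, sq_abs]
  have hsum : ∀ l : ℕ, ∑ i ∈ Finset.Icc (1 : ℤ) n, ‖v (i + l) - v i‖ ^ 2 =
      ∑ c : Fin d, ∑ i ∈ Finset.Icc (1 : ℤ) n, (v (i + l) c - v i c) ^ 2 := by
    intro l
    rw [Finset.sum_comm]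
    refine Finset.sum_congr rfl fun i _ ↦ ?_
    rw [EuclideanSpace.real_norm_sq_eq]
    rfl
  have h1 := hsum 1
  rw [Nat.cast_one] at h1
  rw [hsum k, h1, Finset.mul_sum, Finset.mul_sum]
  refine Finset.sum_le_sum fun c _ ↦ ?_
  have h2 := hcoord c 1
  rw [Nat.cast_one, Nat.cast_one] at h2
  rw [hcoord c k, h2]
  exact sum_norm_shift_sub_le (fun j : ZMod n ↦ ((v (j.val : ℤ) c : ℝ) : ℂ)) hk hkn

lemma sum_offdiag_eq_sum_shift {V : Type*} {n : ℕ} (v : ℤ → V)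
    (hvper : ∀ i : ℤ, v (i + (n : ℤ)) = v i) (Φ : V → ℝ → ℝ) {i : ℤ}
    (hi : i ∈ Finset.Icc (1 : ℤ) n) :
    ∑ j ∈ Finset.Icc (1 : ℤ) n,
      (if i = j then 0 else Φ (v j) ((min |j - i| ((n : ℤ) - |j - i|) : ℤ) : ℝ)) =
    ∑ k ∈ Finset.Icc (1 : ℕ) (n - 1), Φ (v (i + k)) ((min k (n - k) : ℕ) : ℝ) := by
  rw [Finset.mem_Icc] at hi
  have : ∀ j, (if i = j then 0 else Φ (v j) ((min |j - i| ((n : ℤ) - |j - i|) : ℤ) : ℝ)) =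
      if i ≠ j then Φ (v j) ((min |j - i| ((n : ℤ) - |j - i|) : ℤ) : ℝ) else 0 := by
    intro j
    split_ifs <;> simp_all
  simp_rw [this]
  rw [← Finset.sum_filter]
  refine Finset.sum_bij' (fun j _ ↦ (if i < j then j - i else n - (i - j)).toNat)
    (fun k _ ↦ if i + k ≤ n then i + k else i + k - n) ?_ ?_ ?_ ?_ ?_
  · intro j hj
    simp only [Finset.mem_filter, Finset.mem_Icc] at hj ⊢
    split_ifs <;> omega
  · intro k hk
    simp only [Finset.mem_filter, Finset.mem_Icc] at hk ⊢
    split_ifs <;> omega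
  · intro j hj
    simp only [Finset.mem_filter, Finset.mem_Icc] at hj ⊢
    split_ifs <;> omega
  · intro k hk
    simp only [Finset.mem_Icc] at hk ⊢
    split_ifs <;> omega
  · intro j hj
    simp only [Finset.mem_filter, Finset.mem_Icc] at hj ⊢
    congr 1
    · split_ifs with h
      · congr 1; omega
      · rw [← hvper j]; congr 1; omega
    · have : (min |j - i| ((n : ℤ) - |j - i|) : ℤ) =
          ((min (if i < j then j - i else n - (i - j)).toNat
            (n - (if i < j then j - i else n - (i - j)).toNat) : ℕ) : ℤ) := by
        split_ifs with h
        · rw [abs_of_pos (by omega)]; omega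
        · rw [abs_of_neg (by omega)]; omega
      rw [this, Int.cast_natCast]

lemma eq_cos_smul_add_sin_smul {E : Type*} [AddCommGroup E] [Module ℝ E] {e : ℤ → E} {t : ℝ}
    {a b : E} (hrec : ∀ i, e (i + 1) + e (i - 1) = (2 * cos t) • e i) (h0 : e 0 = a)
    (h1 : e 1 = cos t • a + sin t • b) (i : ℤ) :
    e i = cos (i * t) • a + sin (i * t) • b := by
  have step : ∀ x : ℝ, (2 * cos t) • (cos x • a + sin x • b) =
      (cos (x + t) • a + sin (x + t) • b) + (cos (x - t) • a + sin (x - t) • b) := by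
    intro x
    rw [cos_add, sin_add, cos_sub, sin_sub]
    module
  have key : ∀ i : ℤ, e i = cos (i * t) • a + sin (i * t) • b ∧
      e (i + 1) = cos ((i + 1) * t) • a + sin ((i + 1) * t) • b := by
    intro i
    induction i with
    | zero => simp [h0, h1]
    | succ i ih =>
      obtain ⟨ih1, ih2⟩ := ih
      push_cast at ih1 ih2 ⊢
      refine ⟨ih2, ?_⟩
      have h := hrec (i + 1)
      rw [ih2, step, add_sub_cancel_right, ih1] at h
      have e1 : ((i : ℝ) + 1) * t - t = i * t := by ring
      have e2 : ((i : ℝ) + 1) * t + t = (i + 1 + 1) * t := by ring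
      rw [e1, e2] at h
      exact add_right_cancel h
    | pred i ih =>
      obtain ⟨ih1, ih2⟩ := ih
      push_cast at ih1 ih2 ⊢
      rw [sub_add_cancel, sub_add_cancel]
      refine ⟨?_, ih1⟩
      have h := hrec (-i)
      rw [ih1, step, ih2] at h
      have e1 : (-(i : ℝ)) * t - t = (-i - 1) * t := by ring
      have e2 : (-(i : ℝ)) * t + t = (-i + 1) * t := by ring
      rw [e1, e2] at h
      exact add_left_cancel h
  exact (key i).1

lemma eq_add_of_forall_diff_eq {E : Type*} [AddCommGroup E] {v w : ℤ → E}
    (h : ∀ i, v (i + 1) - v i = w (i + 1) - w i) (i : ℤ) : v i = (v 0 - w 0) + w i := by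
  have key : ∀ i, v i - w i = v 0 - w 0 := by
    intro i
    induction i with
    | zero => rfl
    | succ i ih => rw [← ih, sub_eq_sub_iff_sub_eq_sub]; exact h i
    | pred i ih =>
      have := h (-i - 1)
      rw [sub_add_cancel] at this
      rw [← ih, eq_comm, sub_eq_sub_iff_sub_eq_sub]
      exact this
  rw [← key i, sub_add_cancel]

lemma sin_pi_div_pos {n : ℕ} (hn : 2 ≤ n) : 0 < sin (π / n) := by
  have : (2 : ℝ) ≤ n := by exact_mod_cast hn
  refine sin_pos_of_pos_of_lt_pi (by positivity) ?_
  rw [div_lt_iff₀ (by positivity)]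
  nlinarith [pi_pos]

lemma isRegularNGon_of_forall_norm_eq {d n : ℕ} (hn : 3 ≤ n)
    {v : ℤ → EuclideanSpace ℝ (Fin d)}
    (hdist : ∀ k : ℕ, 1 ≤ k → k ≤ 3 → ∀ i : ℤ,
      ‖v (i + k) - v i‖ = sin (k * (π / n)) / (n * sin (π / n))) :
    IsRegularNGon d n v := by
  have hn0 : (0 : ℝ) < n := by exact_mod_cast (by omega : 0 < n)
  have hsx := sin_pi_div_pos (n := n) (by omega)
  set x := π / n with hx
  have hs : 0 < sin (2 * x) := by
    have : (3 : ℝ) ≤ n := by exact_mod_cast hn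
    refine sin_pos_of_pos_of_lt_pi (by positivity) ?_
    rw [hx, ← mul_div_assoc, div_lt_iff₀ (by positivity)]
    nlinarith [pi_pos]
  set e : ℤ → EuclideanSpace ℝ (Fin d) := fun i ↦ v (i + 1) - v i with he
  have d1 : ∀ i, inner ℝ (e i) (e i) = 1 / (n : ℝ) ^ 2 := by
    intro i
    have h := hdist 1 le_rfl (by norm_num) i
    rw [Nat.cast_one, Nat.cast_one, one_mul] at h
    rw [real_inner_self_eq_norm_sq]
    simp only [he]
    rw [h]
    field_simp
  have d2 : ∀ i, inner ℝ (e i) (e (i + 1)) = cos (2 * x) / (n : ℝ) ^ 2 := by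
    intro i
    have h := hdist 2 (by norm_num) (by norm_num) i
    have hv : v (i + (2 : ℕ)) - v i = e i + e (i + 1) := by
      simp only [he]
      rw [add_assoc i 1 1]
      norm_num
    have hsq : ‖e i + e (i + 1)‖ ^ 2 = (2 * cos x) ^ 2 / (n : ℝ) ^ 2 := by
      rw [← hv, h]
      push_cast
      rw [sin_two_mul]
      field_simp
    rw [norm_add_sq_real, ← real_inner_self_eq_norm_sq, ← real_inner_self_eq_norm_sq, d1, d1]
      at hsq
    rw [cos_two_mul]
    field_simp at hsq ⊢
    linarith
  have d3 : ∀ i, inner ℝ (e i) (e (i + 2)) = (2 * cos (2 * x) ^ 2 - 1) / (n : ℝ) ^ 2 := by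
    intro i
    have h := hdist 3 (by norm_num) (by norm_num) i
    have hv : v (i + (3 : ℕ)) - v i = (e i + e (i + 1)) + e (i + 2) := by
      simp only [he]
      rw [add_assoc i 1 1, add_assoc i 2 1]
      norm_num
    have hsq : ‖(e i + e (i + 1)) + e (i + 2)‖ ^ 2 = (2 * cos (2 * x) + 1) ^ 2 / (n : ℝ) ^ 2 := by
      rw [← hv, h]
      push_cast
      have : sin (3 * x) = sin x * (2 * cos (2 * x) + 1) := by
        rw [sin_three_mul, cos_two_mul, cos_sq']
        ring
      rw [this]
      field_simp
    have d2' := d2 (i + 1)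
    rw [add_assoc i 1 1, one_add_one_eq_two] at d2'
    rw [← real_inner_self_eq_norm_sq] at hsq
    simp only [inner_add_left, inner_add_right] at hsq
    rw [real_inner_comm (e i) (e (i + 1)), real_inner_comm (e i) (e (i + 2)),
      real_inner_comm (e (i + 1)) (e (i + 2)), d1, d1, d1, d2, d2'] at hsq
    field_simp at hsq ⊢
    linarith
  have hrec : ∀ i, e (i + 1) + e (i - 1) = (2 * cos (2 * x)) • e i := by
    intro i
    have a1 := d2 (i - 1)
    have a2 := d2 i
    have a3 := d3 (i - 1)
    rw [sub_add_cancel] at a1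
    rw [show i - 1 + 2 = i + 1 by ring] at a3
    rw [← sub_eq_zero, ← norm_eq_zero, ← sq_eq_zero_iff, ← real_inner_self_eq_norm_sq]
    simp only [inner_add_left, inner_add_right, inner_sub_left, inner_sub_right,
      real_inner_smul_left, real_inner_smul_right]
    rw [real_inner_comm (e (i - 1)) (e (i + 1)), real_inner_comm (e i) (e (i + 1)),
      real_inner_comm (e (i - 1)) (e i), d1, d1, d1, a1, a2, a3]
    ring
  set f₁ : EuclideanSpace ℝ (Fin d) := (n : ℝ) • e 0 with hf₁
  set f₂ : EuclideanSpace ℝ (Fin d) := (n / sin (2 * x)) • (e 1 - cos (2 * x) • e 0) with hf₂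
  have hsc := sin_sq_add_cos_sq (2 * x)
  have d2z := d2 0
  rw [zero_add] at d2z
  have n1 : ‖f₁‖ = 1 := by
    rw [← sq_eq_sq₀ (norm_nonneg _) zero_le_one, ← real_inner_self_eq_norm_sq, hf₁,
      real_inner_smul_left, real_inner_smul_right, d1]
    field_simp
  have n2 : ‖f₂‖ = 1 := by
    rw [← sq_eq_sq₀ (norm_nonneg _) zero_le_one, ← real_inner_self_eq_norm_sq, hf₂,
      real_inner_smul_left, real_inner_smul_right]
    simp only [inner_sub_left, inner_sub_right, real_inner_smul_left, real_inner_smul_right]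
    rw [real_inner_comm (e 0) (e 1), d1, d1, d2z]
    field_simp
    linarith
  have n12 : inner ℝ f₁ f₂ = 0 := by
    rw [hf₁, hf₂, real_inner_smul_left, real_inner_smul_right, inner_sub_right,
      real_inner_smul_right, d1, d2z]
    ring
  have hsol := eq_cos_smul_add_sin_smul (a := (1 / n : ℝ) • f₁) (b := (1 / n : ℝ) • f₂) hrec
    (by rw [hf₁, smul_smul, one_div_mul_cancel hn0.ne', one_smul])
    (by
      rw [hf₁, hf₂]
      simp only [smul_smul]
      rw [one_div_mul_cancel hn0.ne',
        show sin (2 * x) * (1 / n * (n / sin (2 * x))) = 1 by field_simp]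
      module)
  set w : ℤ → EuclideanSpace ℝ (Fin d) := fun i ↦ (1 / (2 * n * sin (π / n))) •
      (cos (2 * π * i / n + (-(π / 2) - x)) • f₁ + sin (2 * π * i / n + (-(π / 2) - x)) • f₂)
    with hw
  refine ⟨v 0 - w 0, f₁, f₂, -(π / 2) - x, n1, n2, n12, ?_⟩
  refine eq_add_of_forall_diff_eq fun i ↦ ?_
  have ha : 2 * π * ((i + 1 : ℤ) : ℝ) / n + (-(π / 2) - x) = (i * (2 * x) + x) - π / 2 := by
    push_cast
    rw [hx]
    ring
  have hb : 2 * π * (i : ℝ) / n + (-(π / 2) - x) = (i * (2 * x) - x) - π / 2 := by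
    rw [hx]
    ring
  change e i = w (i + 1) - w i
  rw [hsol i]
  simp only [hw]
  rw [ha, hb, cos_sub_pi_div_two, cos_sub_pi_div_two, sin_sub_pi_div_two, sin_sub_pi_div_two,
    sin_add, sin_sub, cos_add, cos_sub, ← hx]
  match_scalars <;> field_simp <;> ring

lemma IsRegularNGon.norm_eq {d n : ℕ} (hn : 2 ≤ n) {v : ℤ → EuclideanSpace ℝ (Fin d)}
    (h : IsRegularNGon d n v) {k : ℕ} (hkn : k ≤ n) (i : ℤ) :
    ‖v (i + k) - v i‖ = sin (k * (π / n)) / (n * sin (π / n)) := by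
  obtain ⟨o, e₁, e₂, θ, h1, h2, h12, hv⟩ := h
  have hn0 : (0 : ℝ) < n := by exact_mod_cast (by omega : 0 < n)
  have hsx := sin_pi_div_pos hn
  have hk : 0 ≤ sin (k * (π / n)) := by
    refine sin_nonneg_of_nonneg_of_le_pi (by positivity) ?_
    rw [← mul_div_assoc, div_le_iff₀ hn0, mul_comm]
    gcongr
  rw [← sq_eq_sq₀ (norm_nonneg _) (by positivity), hv, hv, add_sub_add_left_eq_sub, ← smul_sub,
    norm_smul, mul_pow, norm_eq_abs, sq_abs]
  set b := 2 * π * (i : ℝ) / n + θ with hb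
  have ha : 2 * π * ((i + k : ℤ) : ℝ) / n + θ = b + 2 * (k * (π / n)) := by
    rw [hb]; push_cast; ring
  rw [ha]
  set a := b + 2 * (k * (π / n))
  have hnorm : ‖cos a • e₁ + sin a • e₂ - (cos b • e₁ + sin b • e₂)‖ ^ 2 =
      (cos a - cos b) ^ 2 + (sin a - sin b) ^ 2 := by
    have : cos a • e₁ + sin a • e₂ - (cos b • e₁ + sin b • e₂) =
        (cos a - cos b) • e₁ + (sin a - sin b) • e₂ := by module
    rw [this, norm_add_sq_real, norm_smul, norm_smul, h1, h2, real_inner_smul_left,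
      real_inner_smul_right, h12]
    simp
  have hcos : (cos a - cos b) ^ 2 + (sin a - sin b) ^ 2 = 4 * sin (k * (π / n)) ^ 2 := by
    have e1 : cos (2 * (k * (π / n))) = cos a * cos b + sin a * sin b := by
      rw [← cos_sub]; congr 1; simp [a]
    rw [cos_two_mul, cos_sq'] at e1
    nlinarith [sin_sq_add_cos_sq a, sin_sq_add_cos_sq b]
  rw [hnorm, hcos]
  field_simp
  norm_num

lemma sin_nat_mul_le {x : ℝ} (k : ℕ) (hx : 0 ≤ sin x) : |sin (k * x)| ≤ k * sin x := by
  induction k with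
  | zero => simp
  | succ k ih =>
    push_cast
    rw [add_mul, one_mul, sin_add]
    calc |sin (k * x) * cos x + cos (k * x) * sin x|
        ≤ |sin (k * x)| * |cos x| + |cos (k * x)| * |sin x| := by
          rw [← abs_mul, ← abs_mul]; exact abs_add_le _ _
      _ ≤ |sin (k * x)| * 1 + 1 * |sin x| := by
          gcongr <;> exact abs_cos_le_one _
      _ ≤ (k + 1) * sin x := by rw [abs_of_nonneg hx]; linarith

lemma norm_shift_sub_le {E : Type*} [SeminormedAddCommGroup E] {v : ℤ → E} {c : ℝ}
    (hedge : ∀ i : ℤ, ‖v (i + 1) - v i‖ = c) (k : ℕ) (i : ℤ) : ‖v (i + k) - v i‖ ≤ k * c := by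
  induction k with
  | zero => simp
  | succ k ih =>
    push_cast
    have h := hedge (i + k)
    calc ‖v (i + (k + 1)) - v i‖ = ‖(v (i + k + 1) - v (i + k)) + (v (i + k) - v i)‖ := by
          rw [sub_add_sub_cancel, add_assoc]
      _ ≤ _ := norm_add_le _ _
      _ ≤ _ := by rw [h]; linarith

lemma sin_min_mul_pi_div {n k : ℕ} (hk : k ≤ n) :
    sin ((min k (n - k) : ℕ) * (π / n)) = sin (k * (π / n)) := by
  rcases min_choice k (n - k) with h | h
  · rw [h]
  · rw [h]
    rcases Nat.eq_zero_or_pos n with rfl | hn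
    · simp
    · exact sin_sub_mul_pi_div hn hk

lemma sin_nat_mul_pi_div_pos {n k : ℕ} (hk : 1 ≤ k) (hkn : k < n) : 0 < sin (k * (π / n)) := by
  have hn0 : (0 : ℝ) < n := by exact_mod_cast (by omega : 0 < n)
  have hk0 : (0 : ℝ) < k := by exact_mod_cast hk
  refine sin_pos_of_pos_of_lt_pi (by positivity) ?_
  rw [← mul_div_assoc, div_lt_iff₀ hn0, mul_comm]
  gcongr

lemma discPolyE_eq_sum {d n : ℕ} {α q : ℝ} {v : ℤ → EuclideanSpace ℝ (Fin d)}
    (hvper : ∀ i : ℤ, v (i + (n : ℤ)) = v i) :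
    discPolyE d n α q v = (1 / (α * (n : ℝ) ^ 2)) *
      ∑ k ∈ Finset.Icc (1 : ℕ) (n - 1), ∑ i ∈ Finset.Icc (1 : ℤ) (n : ℤ),
        (‖v (i + k) - v i‖ ^ (-α) - (((min k (n - k) : ℕ) : ℝ) / n) ^ (-α)) ^ q := by
  rw [discPolyE, Finset.sum_comm (s := Finset.Icc (1 : ℕ) (n - 1))]
  congr 1
  refine Finset.sum_congr rfl fun i hi ↦ ?_
  exact sum_offdiag_eq_sum_shift v hvper
    (fun p t ↦ (‖p - v i‖ ^ (-α) - (t / n) ^ (-α)) ^ q) hi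

lemma regular_energy_eq_sum {n : ℕ} (hn : 2 ≤ n) {α q : ℝ} (hα : 0 < α) :
    (n : ℝ) ^ (α * q - 1) / α *
        ∑ k ∈ Finset.Icc (1 : ℕ) (n - 1),
          (sin (π / n) ^ α / sin (((min k (n - k) : ℕ) : ℝ) * π / n) ^ α -
            1 / ((min k (n - k) : ℕ) : ℝ) ^ α) ^ q =
      (1 / (α * (n : ℝ) ^ 2)) *
        ∑ k ∈ Finset.Icc (1 : ℕ) (n - 1), (n : ℝ) *
          ((sin (k * (π / n)) / (n * sin (π / n))) ^ (-α) -
            (((min k (n - k) : ℕ) : ℝ) / n) ^ (-α)) ^ q := by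
  have hn0 : (0 : ℝ) < n := by exact_mod_cast (by omega : 0 < n)
  have hsx := sin_pi_div_pos hn
  have hterm : ∀ k ∈ Finset.Icc 1 (n - 1),
      (n : ℝ) * ((sin (k * (π / n)) / (n * sin (π / n))) ^ (-α) -
        (((min k (n - k) : ℕ) : ℝ) / n) ^ (-α)) ^ q =
      ((n : ℝ) * n ^ (α * q)) * (sin (π / n) ^ α / sin (((min k (n - k) : ℕ) : ℝ) * π / n) ^ α -
            1 / ((min k (n - k) : ℕ) : ℝ) ^ α) ^ q := by
    intro k hk
    rw [Finset.mem_Icc] at hk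
    have hm1 : 1 ≤ min k (n - k) := by omega
    have hsk : 0 < sin (((min k (n - k) : ℕ) : ℝ) * (π / n)) :=
      sin_nat_mul_pi_div_pos hm1 (by omega)
    have hm0 : (0 : ℝ) < ((min k (n - k) : ℕ) : ℝ) := by exact_mod_cast hm1
    rw [← sin_min_mul_pi_div (by omega : k ≤ n), mul_div_assoc]
    have hsm : sin (((min k (n - k) : ℕ) : ℝ) * (π / n)) ≤
        ((min k (n - k) : ℕ) : ℝ) * sin (π / n) :=
      (le_abs_self _).trans (sin_nat_mul_le _ hsx.le)
    generalize ((min k (n - k) : ℕ) : ℝ) = m at hsk hm0 hsm ⊢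
    have hbase : (sin (m * (π / n)) / (n * sin (π / n))) ^ (-α) - (m / n) ^ (-α) =
        (n : ℝ) ^ α * (sin (π / n) ^ α / sin (m * (π / n)) ^ α - 1 / m ^ α) := by
      rw [rpow_neg (by positivity), rpow_neg (by positivity), div_rpow hsk.le (by positivity),
        div_rpow hm0.le hn0.le, mul_rpow hn0.le hsx.le, inv_div, inv_div]
      ring
    have hnonneg : 0 ≤ sin (π / n) ^ α / sin (m * (π / n)) ^ α - 1 / m ^ α := by
      rw [sub_nonneg, div_le_div_iff₀ (by positivity) (by positivity), one_mul,
        ← mul_rpow hsx.le hm0.le]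
      exact rpow_le_rpow hsk.le (by linarith) hα.le
    rw [hbase, mul_rpow (by positivity) hnonneg, ← rpow_mul hn0.le, mul_assoc]
  rw [Finset.sum_congr rfl hterm, ← Finset.mul_sum, ← mul_assoc, rpow_sub_one hn0.ne']
  congr 1
  field_simp


theorem stmt18 (d n : ℕ) (hd : 2 ≤ d) (hn : 4 ≤ n) (α q : ℝ) (hα : 0 < α) (hq : 1 ≤ q)
    (v : ℤ → EuclideanSpace ℝ (Fin d))
    (hvper : ∀ i : ℤ, v (i + (n : ℤ)) = v i)
    (hvinj : Set.InjOn v (Set.Icc (1 : ℤ) (n : ℤ)))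
    (hedge : ∀ i : ℤ, ‖v (i + 1) - v i‖ = 1 / n) :
    discPolyE d n α q v ≥
      (n : ℝ) ^ (α * q - 1) / α *
        ∑ k ∈ Finset.Icc (1 : ℕ) (n - 1),
          (Real.sin (Real.pi / n) ^ α /
              Real.sin (((min k (n - k) : ℕ) : ℝ) * Real.pi / n) ^ α -
            1 / ((min k (n - k) : ℕ) : ℝ) ^ α) ^ q ∧
    (discPolyE d n α q v =
        (n : ℝ) ^ (α * q - 1) / α *
          ∑ k ∈ Finset.Icc (1 : ℕ) (n - 1),
            (Real.sin (Real.pi / n) ^ α /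
                Real.sin (((min k (n - k) : ℕ) : ℝ) * Real.pi / n) ^ α -
              1 / ((min k (n - k) : ℕ) : ℝ) ^ α) ^ q ↔
      IsRegularNGon d n v) := by
  have hn0 : (0 : ℝ) < n := by exact_mod_cast (by omega : 0 < n)
  have hsx := sin_pi_div_pos (n := n) (by omega)
  have hcard : (Finset.Icc (1 : ℤ) (n : ℤ)).card = n := by simp
  have hne : (Finset.Icc (1 : ℤ) (n : ℤ)).Nonempty := by
    rw [← Finset.card_pos, hcard]; omega
  set D : ℕ → ℝ := fun k ↦ sin (k * (π / n)) / (n * sin (π / n)) with hD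
  have hDpos : ∀ k ∈ Finset.Icc 1 (n - 1), 0 < D k := by
    intro k hk
    rw [Finset.mem_Icc] at hk
    exact div_pos (sin_nat_mul_pi_div_pos hk.1 (by omega)) (by positivity)
  have hmin : ∀ k ∈ Finset.Icc 1 (n - 1), (0 : ℝ) < ((min k (n - k) : ℕ) : ℝ) / n := by
    intro k hk
    rw [Finset.mem_Icc] at hk
    have : 0 < min k (n - k) := by omega
    positivity
  have hDle : ∀ k ∈ Finset.Icc 1 (n - 1),
      (((min k (n - k) : ℕ) : ℝ) / n) ^ (-α) ≤ D k ^ (-α) := by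
    intro k hk
    refine rpow_le_rpow_of_nonpos (hDpos k hk) ?_ (by linarith)
    rw [Finset.mem_Icc] at hk
    simp only [hD]
    rw [← sin_min_mul_pi_div (by omega : k ≤ n), div_le_div_iff₀ (by positivity) hn0]
    have := (le_abs_self _).trans (sin_nat_mul_le (x := π / n) (min k (n - k)) hsx.le)
    nlinarith
  have hrpos : ∀ k ∈ Finset.Icc 1 (n - 1), ∀ i ∈ Finset.Icc (1 : ℤ) n,
      0 < ‖v (i + k) - v i‖ := by
    intro k hk i hi
    rw [Finset.mem_Icc] at hk hi
    rw [norm_pos_iff, sub_ne_zero]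
    intro heq
    by_cases h : i + k ≤ n
    · have := hvinj (Set.mem_Icc.2 ⟨by omega, h⟩) (Set.mem_Icc.2 hi) heq
      omega
    · rw [← sub_add_cancel (i + k : ℤ) n, hvper] at heq
      have := hvinj (Set.mem_Icc.2 ⟨by omega, by omega⟩) (Set.mem_Icc.2 hi) heq
      omega
  have hrle : ∀ k ∈ Finset.Icc 1 (n - 1), ∀ i ∈ Finset.Icc (1 : ℤ) n,
      (((min k (n - k) : ℕ) : ℝ) / n) ^ (-α) ≤ ‖v (i + k) - v i‖ ^ (-α) := by
    intro k hk i hi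
    refine rpow_le_rpow_of_nonpos (hrpos k hk i hi) ?_ (by linarith)
    rw [Finset.mem_Icc] at hk
    have b1 := norm_shift_sub_le hedge k i
    have b2 := norm_shift_sub_le hedge (n - k) (i + k)
    rw [show i + k + ((n - k : ℕ) : ℤ) = i + n by omega, hvper, norm_sub_rev] at b2
    rw [mul_one_div] at b1 b2
    rcases min_choice k (n - k) with h | h <;> rw [h] <;> assumption
  have hsum : ∀ k ∈ Finset.Icc 1 (n - 1),
      ∑ i ∈ Finset.Icc (1 : ℤ) n, ‖v (i + k) - v i‖ ^ 2 ≤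
        (Finset.Icc (1 : ℤ) (n : ℤ)).card * D k ^ 2 := by
    intro k hk
    rw [Finset.mem_Icc] at hk
    have h := sin_sq_mul_sum_norm_sq_le v hvper hk.1 (by omega)
    simp_rw [hedge] at h
    rw [Finset.sum_const, nsmul_eq_mul, hcard] at h
    rw [hcard]
    simp only [hD]
    rw [← mul_le_mul_iff_right₀ (pow_pos hsx 2)]
    refine h.trans_eq ?_
    field_simp
  have hle : ∀ k ∈ Finset.Icc 1 (n - 1),
      (n : ℝ) * (D k ^ (-α) - (((min k (n - k) : ℕ) : ℝ) / n) ^ (-α)) ^ q ≤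
        ∑ i ∈ Finset.Icc (1 : ℤ) (n : ℤ),
          (‖v (i + k) - v i‖ ^ (-α) - (((min k (n - k) : ℕ) : ℝ) / n) ^ (-α)) ^ q := by
    intro k hk
    have h := energy_layer_le hne hα hq (hDpos k hk) (hrpos k hk) (hrle k hk) (hDle k hk)
      (hsum k hk)
    rwa [hcard] at h
  have hC : 0 < 1 / (α * (n : ℝ) ^ 2) := by positivity
  rw [regular_energy_eq_sum (by omega) hα, discPolyE_eq_sum hvper]
  refine ⟨mul_le_mul_of_nonneg_left (Finset.sum_le_sum hle) hC.le, fun heq ↦ ?_, fun hreg ↦ ?_⟩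
  · have heq' := (Finset.sum_eq_sum_iff_of_le hle).1 (mul_left_cancel₀ hC.ne' heq).symm
    refine isRegularNGon_of_forall_norm_eq (by omega) fun k hk hk3 i ↦ ?_
    have hkmem : k ∈ Finset.Icc 1 (n - 1) := by rw [Finset.mem_Icc]; omega
    have h := eq_of_energy_layer_eq hne hα hq (hDpos k hkmem) (hrpos k hkmem) (hrle k hkmem)
      (hDle k hkmem) (hsum k hkmem) (by rw [hcard]; exact heq' k hkmem)
    have hshift : Function.Periodic (fun i : ℤ ↦ ‖v (i + k) - v i‖) (n : ℤ) := by
      intro i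
      simp only
      rw [add_right_comm, hvper, hvper]
    obtain ⟨j, hj, hji⟩ := hshift.exists_mem_Ioc (by omega : (0 : ℤ) < n) i 0
    rw [hji]
    rw [Set.mem_Ioc] at hj
    exact h j (Finset.mem_Icc.2 (by omega))
  · congr 1
    refine Finset.sum_congr rfl fun k hk ↦ ?_
    rw [Finset.mem_Icc] at hk
    rw [Finset.sum_congr rfl fun i _ ↦ by rw [hreg.norm_eq (by omega) (by omega : k ≤ n) i],
      Finset.sum_const, nsmul_eq_mul, hcard]
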